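/- Suppose f31 is identically zero and f11′ is nowhere zero. Assume the structure equations (S1)–(S3) hold and ∂F/∂z_k is nowhere zero. Then there exist no smooth functions a, b, c on any nonempty open set U ⊆ ℝ² satisfying the Codazzi identities (C1), (C2) and the Gauss equation a·c − b² = −1. -/

import Mathlib

open Real Finset

/-- Partial derivative of `f` at `z` in the `i`-th coordinate direction. -/
noncomputable def pd {n : ℕ} (f : (Fin n → ℝ) → ℝ) (z : Fin n → ℝ) (i : ℕ) : ℝ :=
  fderiv ℝ f z (fun j => if (j : ℕ) = i then 1 else 0)

/-- The `i`-th coordinate of `z` (junk value `0` out of range). -/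
def zc {n : ℕ} (z : Fin n → ℝ) (i : ℕ) : ℝ :=
  if h : i < n then z ⟨i, h⟩ else 0

/-- `f` depends only on the first `m` coordinates `z_0, …, z_{m-1}`. -/
def DependsOnFirst {n : ℕ} (m : ℕ) (f : (Fin n → ℝ) → ℝ) : Prop :=
  ∀ z w : Fin n → ℝ, (∀ j : Fin n, (j : ℕ) < m → z j = w j) → f z = f w

/-- The structure equations (S1)–(S3), required at every point `(z_0, …, z_k) ∈ ℝ^{k+1}`. -/
def StructEqs (k : ℕ) (η : ℝ) (f11 f31 : ℝ → ℝ)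
    (f12 f22 f32 F : (Fin (k+1) → ℝ) → ℝ) : Prop :=
  ∀ z : Fin (k+1) → ℝ,
    deriv f11 (z 0) * F z =
      (∑ i ∈ Finset.range k, pd f12 z i * zc z (i+1)) + η * f32 z - f31 (z 0) * f22 z ∧
    (∑ i ∈ Finset.range (k-1), pd f22 z i * zc z (i+1)) =
      f11 (z 0) * f32 z - f31 (z 0) * f12 z ∧
    deriv f31 (z 0) * F z =
      (∑ i ∈ Finset.range k, pd f32 z i * zc z (i+1)) + η * f12 z - f11 (z 0) * f22 z

/-- The Codazzi identities (C1) and (C2), required for every `(x,t) ∈ U` and every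
`(z_0, …, z_{k-1})` (equivalently, every `z ∈ ℝ^{k+1}` since the data does not
depend on `z_k`).  Here `(1,0)` is the `∂/∂x` direction and `(0,1)` the `∂/∂t` one. -/
def Codazzi (k : ℕ) (η : ℝ) (f11 f31 : ℝ → ℝ) (f12 f22 f32 : (Fin (k+1) → ℝ) → ℝ)
    (U : Set (ℝ × ℝ)) (a b c : ℝ × ℝ → ℝ) : Prop :=
  ∀ p ∈ U, ∀ z : Fin (k+1) → ℝ,
    f11 (z 0) * fderiv ℝ a p (0, 1) + η * fderiv ℝ b p (0, 1)
      - f12 z * fderiv ℝ a p (1, 0) - f22 z * fderiv ℝ b p (1, 0)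
      - 2 * b p * (f11 (z 0) * f32 z - f31 (z 0) * f12 z)
      + (a p - c p) * (η * f32 z - f31 (z 0) * f22 z) = 0 ∧
    f11 (z 0) * fderiv ℝ b p (0, 1) + η * fderiv ℝ c p (0, 1)
      - f12 z * fderiv ℝ b p (1, 0) - f22 z * fderiv ℝ c p (1, 0)
      + (a p - c p) * (f11 (z 0) * f32 z - f31 (z 0) * f12 z)
      + 2 * b p * (η * f32 z - f31 (z 0) * f22 z) = 0

/-- The `i`-th coordinate direction, zero when `i` is out of range. -/
def coordDir (n i : ℕ) : Fin n → ℝ := fun j => if (j : ℕ) = i then 1 else 0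

lemma hasDerivAt_coordLine {n : ℕ} {f : (Fin n → ℝ) → ℝ} (hf : Differentiable ℝ f)
    (z : Fin n → ℝ) (i : ℕ) (s : ℝ) :
    HasDerivAt (fun s : ℝ => f (z + s • coordDir n i)) (pd f (z + s • coordDir n i) i) s := by
  have hline : HasDerivAt (fun s : ℝ => z + s • coordDir n i) (coordDir n i) s := by
    simpa using ((hasDerivAt_id s).smul_const (coordDir n i)).const_add z
  exact (hf _).hasFDerivAt.comp_hasDerivAt s hline

lemma exists_ne_of_pd_ne_zero {n : ℕ} {f : (Fin n → ℝ) → ℝ} (hf : Differentiable ℝ f)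
    {z : Fin n → ℝ} {i : ℕ} (h : pd f z i ≠ 0) :
    ∃ s : ℝ, f (z + s • coordDir n i) ≠ f z := by
  by_contra! hconst
  have hd := hasDerivAt_coordLine hf z i 0
  simp only [hconst, zero_smul, add_zero] at hd
  exact h (hd.unique (hasDerivAt_const (0 : ℝ) (f z)))

lemma coordDir_of_ne {n i : ℕ} {j : Fin n} (h : (j : ℕ) ≠ i) : coordDir n i j = 0 := if_neg h

lemma zc_add_smul_coordDir {n : ℕ} (z : Fin n → ℝ) (s : ℝ) {j : ℕ} (hj : j < n) (i : ℕ) :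
    zc (z + s • coordDir n j) i = zc z i + if i = j then s else 0 := by
  unfold zc coordDir
  by_cases hi : i < n
  · simp [hi]
  · simp [hi, show i ≠ j by omega]

lemma sum_mul_zc_add_smul_coordDir {n N j : ℕ} (p : ℕ → ℝ) (z : Fin n → ℝ) (s : ℝ)
    (hj : j + 1 < n) (hjN : j < N) :
    ∑ i ∈ Finset.range N, p i * zc (z + s • coordDir n (j + 1)) (i + 1) =
      (∑ i ∈ Finset.range N, p i * zc z (i + 1)) + p j * s := by
  simp [zc_add_smul_coordDir z s hj, mul_add, Finset.sum_add_distrib, hjN]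

namespace DependsOnFirst

variable {n m : ℕ} {f : (Fin n → ℝ) → ℝ}

lemma apply_add_smul (hf : DependsOnFirst m f) {i : ℕ} (hi : m ≤ i) (z : Fin n → ℝ) (s : ℝ) :
    f (z + s • coordDir n i) = f z :=
  hf _ _ fun j hj => by simp [coordDir_of_ne (show (j : ℕ) ≠ i by omega)]

lemma pd (hf : DependsOnFirst m f) (i : ℕ) : DependsOnFirst m (fun z => pd f z i) := by
  intro z w h
  have hshift : (fun x => f (x + (w - z))) = f := by
    funext x
    exact hf _ _ fun j hj => by simp [h j hj]
  have hd : fderiv ℝ f z = fderiv ℝ f w := by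
    conv_lhs => rw [← hshift]
    rw [fderiv_comp_add_right, add_sub_cancel]
  simp only [_root_.pd, hd]

lemma of_pd_eq_zero (hf : DependsOnFirst (m + 1) f) (hd : Differentiable ℝ f)
    (h : ∀ z, _root_.pd f z m = 0) : DependsOnFirst m f := by
  intro z w hzw
  have hconst := is_const_of_deriv_eq_zero (f := fun s : ℝ => f (z + s • coordDir n m))
    (fun s => (hasDerivAt_coordLine hd z m s).differentiableAt)
    (fun s => (hasDerivAt_coordLine hd z m s).deriv.trans (h _)) 0 (zc w m - zc z m)
  simp only [zero_smul, add_zero] at hconst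
  rw [hconst]
  refine hf _ _ fun j hj => ?_
  rcases Nat.lt_succ_iff_lt_or_eq.mp hj with hlt | rfl
  · simp [coordDir_of_ne hlt.ne, hzw j hlt]
  · simp [coordDir, zc]

end DependsOnFirst

lemma apply_zero_ne_apply_one_of_deriv_ne_zero {f : ℝ → ℝ} (hf : Continuous f)
    (h : ∀ x, deriv f x ≠ 0) : f 0 ≠ f 1 := fun heq => by
  obtain ⟨x, -, hx⟩ := exists_deriv_eq_zero zero_lt_one hf.continuousOn heq
  exact h x hx

/-- Proposition 3(ii) of the paper.  If `f31 ≡ 0` and `f11'` is nowhere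
zero, then under the structure equations with `∂F/∂z_k` nowhere zero, no smooth
`a, b, c` on a nonempty open set satisfy the Codazzi identities and the Gauss equation. -/
theorem stmt6 (k : ℕ) (hk : 2 ≤ k) (η : ℝ) (hη : η ≠ 0)
    (f11 f31 : ℝ → ℝ) (f12 f22 f32 F : (Fin (k+1) → ℝ) → ℝ)
    (hf11 : ContDiff ℝ (⊤ : ℕ∞) f11) (hf31 : ContDiff ℝ (⊤ : ℕ∞) f31)
    (hf12 : ContDiff ℝ (⊤ : ℕ∞) f12) (hf22 : ContDiff ℝ (⊤ : ℕ∞) f22)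
    (hf32 : ContDiff ℝ (⊤ : ℕ∞) f32) (hF : ContDiff ℝ (⊤ : ℕ∞) F)
    (hdep12 : DependsOnFirst k f12) (hdep32 : DependsOnFirst k f32)
    (hdep22 : DependsOnFirst (k-1) f22)
    (h31 : ∀ z0 : ℝ, f31 z0 = 0) (h11d : ∀ z0 : ℝ, deriv f11 z0 ≠ 0)
    (hS : StructEqs k η f11 f31 f12 f22 f32 F)
    (hFk : ∀ z : Fin (k+1) → ℝ, pd F z k ≠ 0) :
    ¬ ∃ (U : Set (ℝ × ℝ)) (a b c : ℝ × ℝ → ℝ),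
      U.Nonempty ∧ IsOpen U ∧
      ContDiffOn ℝ (⊤ : ℕ∞) a U ∧ ContDiffOn ℝ (⊤ : ℕ∞) b U ∧
      ContDiffOn ℝ (⊤ : ℕ∞) c U ∧
      Codazzi k η f11 f31 f12 f22 f32 U a b c ∧
      (∀ p ∈ U, a p * c p - (b p) ^ 2 = -1) := by
  rintro ⟨U, a, b, c, ⟨p, hp⟩, -, -, -, -, hC, hG⟩
  obtain ⟨m, rfl⟩ : ∃ m, k = m + 2 := ⟨k - 2, by omega⟩
  simp only [show m + 2 - 1 = m + 1 by omega] at *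
  have d12 : Differentiable ℝ f12 := hf12.differentiable (by simp)
  have d32 : Differentiable ℝ f32 := hf32.differentiable (by simp)
  have dF : Differentiable ℝ F := hF.differentiable (by simp)
  have h31' : ∀ x, deriv f31 x = 0 := by
    rw [show f31 = fun _ => 0 from funext h31]; simp
  have hzero : ∀ (z : Fin (m + 2 + 1) → ℝ) (s : ℝ) (i : ℕ), i ≠ 0 →
      (z + s • coordDir (m + 2 + 1) i) 0 = z 0 := fun z s i hi => by
    simp [coordDir_of_ne (j := (0 : Fin (m + 2 + 1))) (by simpa using hi.symm)]
  have p12 : ∀ z, pd f12 z (m + 1) ≠ 0 := by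
    intro z h
    obtain ⟨s, hs⟩ := exists_ne_of_pd_ne_zero dF (hFk z)
    have h1 := (hS z).1
    have h2 := (hS (z + s • coordDir _ (m + 2))).1
    simp only [fun i => (hdep12.pd i).apply_add_smul le_rfl z s, hdep32.apply_add_smul le_rfl z s,
      hzero z s (m + 2) (by omega), h31] at h1 h2
    rw [sum_mul_zc_add_smul_coordDir _ z s (by omega) (by omega), h] at h2
    exact hs (mul_left_cancel₀ (h11d (z 0)) (by linarith))
  have p32 : ∀ z, pd f32 z (m + 1) = 0 := by
    intro z
    have h1 := (hS z).2.2
    have h2 := (hS (z + (1 : ℝ) • coordDir _ (m + 2))).2.2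
    simp only [fun i => (hdep32.pd i).apply_add_smul le_rfl z 1, hdep12.apply_add_smul le_rfl z 1,
      hdep22.apply_add_smul (Nat.le_succ _) z 1, hzero z 1 (m + 2) (by omega), h31'] at h1 h2
    rw [sum_mul_zc_add_smul_coordDir _ z 1 (by omega) (by omega)] at h2
    linarith
  have hdep32' : DependsOnFirst (m + 1) f32 := hdep32.of_pd_eq_zero d32 p32
  have q32 : ∀ z, pd f32 z m ≠ 0 := by
    intro z h
    obtain ⟨s, hs⟩ := exists_ne_of_pd_ne_zero d12 (p12 z)
    have h1 := (hS z).2.2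
    have h2 := (hS (z + s • coordDir _ (m + 1))).2.2
    simp only [fun i => (hdep32'.pd i).apply_add_smul le_rfl z s,
      hdep22.apply_add_smul le_rfl z s, hzero z s (m + 1) (by omega), h31'] at h1 h2
    rw [sum_mul_zc_add_smul_coordDir _ z s (by omega) (by omega), h] at h2
    exact hs (mul_left_cancel₀ hη (by linarith))
  have h01 := apply_zero_ne_apply_one_of_deriv_ne_zero hf11.continuous h11d
  obtain ⟨ax, bx⟩ : fderiv ℝ a p (1, 0) = 0 ∧ fderiv ℝ b p (1, 0) = 0 := by
    obtain ⟨s, hs⟩ := exists_ne_of_pd_ne_zero d12 (p12 0)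
    have h1 := hC p hp 0
    have h2 := hC p hp (0 + s • coordDir _ (m + 1))
    simp only [hdep32'.apply_add_smul le_rfl 0 s, hdep22.apply_add_smul le_rfl 0 s,
      hzero 0 s (m + 1) (by omega), h31] at h1 h2
    constructor
    · refine (mul_eq_zero.mp ?_).resolve_left (sub_ne_zero.mpr hs)
      linarith [h1.1, h2.1]
    · refine (mul_eq_zero.mp ?_).resolve_left (sub_ne_zero.mpr hs)
      linarith [h1.2, h2.2]
  rcases Nat.eq_zero_or_pos m with rfl | hm
  · -- For `k = 2` the second structure equation already forces `f32 = 0` where `f11 ≠ 0`.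
    have hprod : ∀ z, f11 (z 0) * f32 z = 0 := by
      intro z
      have h := (hS (fun j => if j = 0 then z 0 else 0)).2.1
      rw [hdep32' _ z fun j hj => by simp [show j = 0 by ext; simpa using hj]] at h
      simpa [zc, h31] using h.symm
    obtain ⟨x, hx⟩ : ∃ x, f11 x ≠ 0 := by
      by_contra! h
      exact h01 (by rw [h, h])
    refine q32 (fun _ => x) ?_
    have hev : f32 =ᶠ[nhds fun _ => x] fun _ => 0 := by
      have hcont : Continuous fun z : Fin (0 + 2 + 1) → ℝ => f11 (z 0) :=
        hf11.continuous.comp (continuous_apply 0)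
      filter_upwards [hcont.continuousAt.eventually_ne hx] with z hz
      exact (mul_eq_zero.mp (hprod z)).resolve_left hz
    simp [pd, hev.fderiv_eq]
  · have hlin : ∀ x, -2 * b p * f11 x + (a p - c p) * η = 0 := by
      intro x
      obtain ⟨s, hs⟩ := exists_ne_of_pd_ne_zero d32 (q32 fun _ => x)
      have h1 := (hC p hp fun _ => x).1
      have h2 := (hC p hp ((fun _ => x) + s • coordDir _ m)).1
      simp only [hzero _ s m hm.ne', h31, ax, bx] at h1 h2
      refine (mul_eq_zero.mp ?_).resolve_right (sub_ne_zero.mpr hs)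
      linarith
    have hb : b p = 0 := by
      refine (mul_eq_zero.mp ?_).resolve_right (sub_ne_zero.mpr h01)
      linarith [hlin 0, hlin 1]
    have hac : a p - c p = 0 := by
      refine (mul_eq_zero.mp ?_).resolve_right hη
      simpa [hb] using hlin 0
    have hg := hG p hp
    rw [hb, ← sub_eq_zero.mp hac] at hg
    nlinarith [mul_self_nonneg (a p)]
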